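/- Let a < b be real numbers and let B_n^{[a,b]} denote the Bernstein operator on C[a,b], B_n^{[a,b]}(f; x) = (1/(b-a)ⁿ)·Σ_{k=0}^{n} C(n,k)(x-a)^k (b-x)^{n-k} f(a + k(b-a)/n). For every positive integers n and r, every f ∈ C[a,b] and every x ∈ [a,b], the r-th iterate satisfies |(B_n^{[a,b]})^r(f; x) - B_1^{[a,b]}(f; x)| ≤ (9/4)·ω₂^{[a,b]}(f, √((x-a)(b-x)·(1 - 1/n)^r)). -/

import Mathlib

open Set Finset

noncomputable section

/-- Second order modulus of smoothness of `f` on `[a,b]`. -/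
def omega2 (a b : ℝ) (f : ℝ → ℝ) (δ : ℝ) : ℝ :=
  sSup {v | ∃ x h : ℝ, x - h ∈ Set.Icc a b ∧ x + h ∈ Set.Icc a b ∧ |h| ≤ δ ∧
    v = |f (x - h) - 2 * f x + f (x + h)|}

/-- The Bernstein operator of degree `n` on `[a,b]`. -/
def bernAB (a b : ℝ) (n : ℕ) (f : ℝ → ℝ) : ℝ → ℝ := fun x =>
  (1 / (b - a) ^ n) * ∑ k ∈ Finset.range (n + 1),
    (n.choose k : ℝ) * (x - a) ^ k * (b - x) ^ (n - k) * f (a + k * (b - a) / (n : ℝ))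

/-- A continuous function vanishing at the endpoints whose second differences of step at most `h`
exceed `-W` is dominated by `W + W / (2 h²) (t - a) (b - t)`. -/
lemma le_of_neg_lt_second_diff {a b h W : ℝ} (hab : a < b) (h0 : 0 < h) (hh : 2 * h ≤ b - a)
    {g : ℝ → ℝ} (hg : ContinuousOn g (Set.Icc a b)) (ga : g a = 0) (gb : g b = 0)
    (hW : ∀ x s, x - s ∈ Set.Icc a b → x + s ∈ Set.Icc a b → |s| ≤ h →
      -W < g (x - s) - 2 * g x + g (x + s)) {t : ℝ} (ht : t ∈ Set.Icc a b) :
    g t ≤ W + W / (2 * h ^ 2) * ((t - a) * (b - t)) := by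
  obtain ⟨c, hc⟩ : ∃ c, c = W / (2 * h ^ 2) := ⟨_, rfl⟩
  have hcW : 2 * c * h ^ 2 = W := by rw [hc]; field_simp
  have hW0 : 0 < W := by
    have := hW a 0 (by simp [hab.le]) (by simp [hab.le]) (by simp [h0.le])
    simp only [sub_zero, add_zero] at this
    linarith
  have hc0 : 0 < c := by rw [hc]; positivity
  rw [← hc]
  obtain ⟨y, hy, hmax⟩ := isCompact_Icc.exists_isMaxOn (Set.nonempty_Icc.2 hab.le)
    (f := fun t => g t - c * ((t - a) * (b - t))) (hg.sub (by fun_prop))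
  replace hmax : ∀ z ∈ Set.Icc a b,
      g z - c * ((z - a) * (b - z)) ≤ g y - c * ((y - a) * (b - y)) := fun z hz => hmax hz
  suffices hy' : g y - c * ((y - a) * (b - y)) ≤ W by linarith [hmax t ht]
  obtain ⟨hya, hyb⟩ := hy
  rcases lt_or_ge (y - a) h with h1 | h1
  · have hm : y + (y - a) ∈ Set.Icc a b := ⟨by linarith, by linarith⟩
    have key := hW y (y - a) (by simp [hab.le]) hm (by rw [abs_of_nonneg] <;> linarith)
    rw [sub_sub_cancel, ga] at key
    nlinarith [hmax _ hm, mul_nonneg hc0.le (sq_nonneg (y - a))]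
  rcases lt_or_ge (b - y) h with h2 | h2
  · have hm : y - (b - y) ∈ Set.Icc a b := ⟨by linarith, by linarith⟩
    have key := hW y (b - y) hm (by simp [hab.le]) (by rw [abs_of_nonneg] <;> linarith)
    rw [add_sub_cancel, gb] at key
    nlinarith [hmax _ hm, mul_nonneg hc0.le (sq_nonneg (b - y))]
  · have hm : y - h ∈ Set.Icc a b := ⟨by linarith, by linarith⟩
    have hp : y + h ∈ Set.Icc a b := ⟨by linarith, by linarith⟩
    have key := hW y h hm hp (abs_of_pos h0).le
    nlinarith [hmax _ hm, hmax _ hp]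

lemma bernAB_eq_sum_bernsteinPolynomial {a b : ℝ} (hab : a < b) (n : ℕ) (f : ℝ → ℝ) (x : ℝ) :
    bernAB a b n f x = ∑ k ∈ Finset.range (n + 1),
      (bernsteinPolynomial ℝ n k).eval ((x - a) / (b - a)) * f (a + k * (b - a) / (n : ℝ)) := by
  have hba : b - a ≠ 0 := (sub_pos.2 hab).ne'
  rw [bernAB, Finset.mul_sum]
  refine Finset.sum_congr rfl fun k hk => ?_
  have hk' : k ≤ n := Nat.lt_succ_iff.1 (Finset.mem_range.1 hk)
  have h1 : 1 - (x - a) / (b - a) = (b - x) / (b - a) := by field_simp; ring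
  simp only [bernsteinPolynomial, Polynomial.eval_mul, Polynomial.eval_pow, Polynomial.eval_sub,
    Polynomial.eval_natCast, Polynomial.eval_X, Polynomial.eval_one, h1, div_pow]
  rw [← Nat.add_sub_cancel' hk', pow_add (b - a), Nat.add_sub_cancel' hk']
  field_simp

/-- The Bernstein operator fixes affine functions and has `(t - a) (b - t)` as an eigenfunction
with eigenvalue `1 - 1 / n`. -/
lemma bernAB_quadratic {a b : ℝ} (hab : a < b) {n : ℕ} (hn : 0 < n) (p q c : ℝ) :
    bernAB a b n (fun t => p + q * (t - a) + c * ((t - a) * (b - t))) =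
      fun t => p + q * (t - a) + c * (1 - 1 / (n : ℝ)) * ((t - a) * (b - t)) := by
  funext x
  have hba : b - a ≠ 0 := (sub_pos.2 hab).ne'
  have hn' : (n : ℝ) ≠ 0 := by positivity
  rw [bernAB_eq_sum_bernsteinPolynomial hab]
  obtain ⟨u, hu⟩ : ∃ u, u = (x - a) / (b - a) := ⟨_, rfl⟩
  have hx : x = a + u * (b - a) := by rw [hu]; field_simp; ring
  rw [← hu]
  have s0 : ∑ k ∈ Finset.range (n + 1), (bernsteinPolynomial ℝ n k).eval u = 1 := by
    simpa [Polynomial.eval_finsetSum] using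
      congrArg (Polynomial.eval u) (bernsteinPolynomial.sum ℝ n)
  have s1 : ∑ k ∈ Finset.range (n + 1), (k : ℝ) * (bernsteinPolynomial ℝ n k).eval u = n * u := by
    simpa [Polynomial.eval_finsetSum] using
      congrArg (Polynomial.eval u) (bernsteinPolynomial.sum_smul ℝ n)
  have s2 : ∑ k ∈ Finset.range (n + 1),
      (k : ℝ) * (k - 1) * (bernsteinPolynomial ℝ n k).eval u = n * (n - 1) * u ^ 2 := by
    have hcast (k : ℕ) : ((k * (k - 1) : ℕ) : ℝ) = (k : ℝ) * (k - 1) := by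
      cases k <;> simp
    have := congrArg (Polynomial.eval u) (bernsteinPolynomial.sum_mul_smul ℝ n)
    simpa only [Polynomial.eval_finsetSum, nsmul_eq_mul, Polynomial.eval_mul,
      Polynomial.eval_natCast, Polynomial.eval_pow, Polynomial.eval_X, hcast] using this
  have expand : ∀ k : ℕ, (bernsteinPolynomial ℝ n k).eval u *
      (p + q * (a + k * (b - a) / n - a) +
        c * ((a + k * (b - a) / n - a) * (b - (a + k * (b - a) / n)))) =
      p * (bernsteinPolynomial ℝ n k).eval u +
      (q * (b - a) / n + c * (b - a) ^ 2 * (n - 1) / n ^ 2) *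
        ((k : ℝ) * (bernsteinPolynomial ℝ n k).eval u) -
      c * (b - a) ^ 2 / n ^ 2 * ((k : ℝ) * (k - 1) * (bernsteinPolynomial ℝ n k).eval u) := by
    intro k
    field_simp
    ring
  simp only [expand]
  rw [Finset.sum_sub_distrib, Finset.sum_add_distrib, ← Finset.mul_sum, ← Finset.mul_sum,
    ← Finset.mul_sum, s0, s1, s2, hx]
  field_simp
  ring

lemma bernAB_iterate_quadratic {a b : ℝ} (hab : a < b) {n : ℕ} (hn : 0 < n) (r : ℕ)
    (p q c : ℝ) :
    (bernAB a b n)^[r] (fun t => p + q * (t - a) + c * ((t - a) * (b - t))) =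
      fun t => p + q * (t - a) + c * (1 - 1 / (n : ℝ)) ^ r * ((t - a) * (b - t)) := by
  induction r with
  | zero => simp
  | succ r ih => rw [Function.iterate_succ_apply', ih, bernAB_quadratic hab hn, pow_succ, mul_assoc]

lemma bernAB_mono {a b : ℝ} (hab : a < b) {n : ℕ} (hn : 0 < n) {f g : ℝ → ℝ}
    (hfg : ∀ t ∈ Set.Icc a b, f t ≤ g t) :
    ∀ t ∈ Set.Icc a b, bernAB a b n f t ≤ bernAB a b n g t := by
  rintro t ⟨hta, htb⟩
  have hba : 0 < b - a := sub_pos.2 hab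
  have h1 : 0 ≤ t - a := sub_nonneg.2 hta
  have h2 : 0 ≤ b - t := sub_nonneg.2 htb
  unfold bernAB
  refine mul_le_mul_of_nonneg_left (Finset.sum_le_sum fun k hk => ?_) (by positivity)
  refine mul_le_mul_of_nonneg_left (hfg _ ⟨?_, ?_⟩) (by positivity)
  · have : 0 ≤ k * (b - a) / (n : ℝ) := by positivity
    linarith
  · have hk' : (k : ℝ) ≤ n := by exact_mod_cast Nat.lt_succ_iff.1 (Finset.mem_range.1 hk)
    have : k * (b - a) / (n : ℝ) ≤ b - a := by
      rw [div_le_iff₀ (by positivity), mul_comm]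
      exact mul_le_mul_of_nonneg_left hk' hba.le
    linarith

lemma bernAB_iterate_mono {a b : ℝ} (hab : a < b) {n : ℕ} (hn : 0 < n) {f g : ℝ → ℝ}
    (hfg : ∀ t ∈ Set.Icc a b, f t ≤ g t) (r : ℕ) :
    ∀ t ∈ Set.Icc a b, (bernAB a b n)^[r] f t ≤ (bernAB a b n)^[r] g t := by
  induction r with
  | zero => exact hfg
  | succ r ih =>
    simp only [Function.iterate_succ_apply']
    exact bernAB_mono hab hn ih

lemma bernAB_iterate_left {a b : ℝ} (hab : a < b) (n r : ℕ) (f : ℝ → ℝ) :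
    (bernAB a b n)^[r] f a = f a := by
  induction r with
  | zero => rfl
  | succ r ih =>
    have hba : b - a ≠ 0 := (sub_pos.2 hab).ne'
    rw [Function.iterate_succ_apply', bernAB, Finset.sum_eq_single 0]
    · simp [ih, hba]
    · intro k _ hk
      simp [hk]
    · simp

lemma bernAB_iterate_right {a b : ℝ} (hab : a < b) {n : ℕ} (hn : 0 < n) (r : ℕ) (f : ℝ → ℝ) :
    (bernAB a b n)^[r] f b = f b := by
  induction r with
  | zero => rfl
  | succ r ih =>
    have hba : b - a ≠ 0 := (sub_pos.2 hab).ne'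
    have hn' : (n : ℝ) ≠ 0 := by positivity
    rw [Function.iterate_succ_apply', bernAB, Finset.sum_eq_single n]
    · have : a + n * (b - a) / n = b := by field_simp; ring
      simp [this, ih, hba]
    · intro k hk hkn
      have hk' : n - k ≠ 0 := by have := Finset.mem_range.1 hk; omega
      simp [hk']
    · simp

lemma bernAB_one {a b : ℝ} (f : ℝ → ℝ) (x : ℝ) :
    bernAB a b 1 f x = ((b - x) * f a + (x - a) * f b) / (b - a) := by
  simp [bernAB, Finset.sum_range_succ]
  ring

lemma bddAbove_second_diff {a b : ℝ} {f : ℝ → ℝ} (hf : ContinuousOn f (Set.Icc a b)) (δ : ℝ) :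
    BddAbove {v | ∃ x h : ℝ, x - h ∈ Set.Icc a b ∧ x + h ∈ Set.Icc a b ∧ |h| ≤ δ ∧
      v = |f (x - h) - 2 * f x + f (x + h)|} := by
  obtain ⟨C, hC⟩ := isCompact_Icc.exists_bound_of_continuousOn hf
  refine ⟨4 * C, ?_⟩
  rintro _ ⟨x, h, hm, hp, -, rfl⟩
  have h1 := abs_le.1 (hC _ hm)
  have h2 := abs_le.1 (hC _ hp)
  have h3 := abs_le.1 (hC x ⟨by linarith [hm.1, hp.1], by linarith [hm.2, hp.2]⟩)
  exact abs_le.2 ⟨by linarith, by linarith⟩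

lemma omega2_nonneg (a b : ℝ) (f : ℝ → ℝ) (δ : ℝ) : 0 ≤ omega2 a b f δ := by
  apply Real.sSup_nonneg
  rintro _ ⟨x, h, -, -, -, rfl⟩
  exact abs_nonneg _

theorem bernsteinAB_iterates
    (a b : ℝ) (hab : a < b) (n r : ℕ) (hn : 0 < n) (hr : 0 < r)
    (f : ℝ → ℝ) (hf : ContinuousOn f (Set.Icc a b))
    (x : ℝ) (hx : x ∈ Set.Icc a b) :
    |(bernAB a b n)^[r] f x - ((b - x) * f a + (x - a) * f b) / (b - a)| ≤
      9 / 4 * omega2 a b f (Real.sqrt ((x - a) * (b - x) * (1 - 1 / (n : ℝ)) ^ r)) := by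
  have hba : 0 < b - a := sub_pos.2 hab
  obtain ⟨hxa, hxb⟩ := hx
  have hn1 : (1 : ℝ) ≤ n := by exact_mod_cast hn
  have hρ0 : 0 ≤ 1 - 1 / (n : ℝ) := by
    rw [sub_nonneg, div_le_one (by positivity)]; exact hn1
  have hρ1 : 1 - 1 / (n : ℝ) ≤ 1 := sub_le_self _ (by positivity)
  have hρr : (1 - 1 / (n : ℝ)) ^ r ≤ 1 := pow_le_one₀ hρ0 hρ1
  have hφ0 : 0 ≤ (x - a) * (b - x) := mul_nonneg (sub_nonneg.2 hxa) (sub_nonneg.2 hxb)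
  obtain ⟨D, hD⟩ : ∃ D, D = (x - a) * (b - x) * (1 - 1 / (n : ℝ)) ^ r := ⟨_, rfl⟩
  have hD0 : 0 ≤ D := by rw [hD]; positivity
  have hω := omega2_nonneg a b f (Real.sqrt D)
  rw [← hD]
  rcases hD0.eq_or_lt with hDz | hDpos
  · suffices heq : (bernAB a b n)^[r] f x = ((b - x) * f a + (x - a) * f b) / (b - a) by
      rw [heq, sub_self, abs_zero]
      positivity
    rw [hD, eq_comm, mul_eq_zero, mul_eq_zero] at hDz
    rcases hDz with (h | h) | h
    · obtain rfl : x = a := by linarith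
      rw [bernAB_iterate_left hab]
      field_simp
      ring
    · obtain rfl : x = b := by linarith
      rw [bernAB_iterate_right hab hn]
      field_simp
      ring
    · have h1 := eq_zero_of_pow_eq_zero h
      have hn' : n = 1 := by
        have : (n : ℝ) = 1 := by
          field_simp at h1
          linarith
        exact_mod_cast this
      subst hn'
      obtain ⟨m, rfl⟩ := Nat.exists_eq_succ_of_ne_zero hr.ne'
      rw [Function.iterate_succ_apply', bernAB_one, bernAB_iterate_left hab,
        bernAB_iterate_right hab one_pos]
  obtain ⟨δ, hδ⟩ : ∃ δ, δ = Real.sqrt D := ⟨_, rfl⟩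
  have hδ0 : 0 < δ := by rw [hδ]; exact Real.sqrt_pos.2 hDpos
  have hδD : δ ^ 2 = D := by rw [hδ]; exact Real.sq_sqrt hD0
  have hδh : 2 * δ ≤ b - a := by
    have hDφ : D ≤ (x - a) * (b - x) := by rw [hD]; exact mul_le_of_le_one_right hφ0 hρr
    refine abs_le_of_sq_le_sq' ?_ hba.le |>.2
    nlinarith [sq_nonneg ((x - a) - (b - x))]
  rw [← hδ] at hω ⊢
  suffices hW : ∀ W, omega2 a b f δ < W →
      |(bernAB a b n)^[r] f x - ((b - x) * f a + (x - a) * f b) / (b - a)| ≤ 3 / 2 * W by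
    have := le_of_forall_gt_imp_ge_of_dense (a₁ := 2 / 3 * |(bernAB a b n)^[r] f x -
      ((b - x) * f a + (x - a) * f b) / (b - a)|) (a₂ := omega2 a b f δ)
      fun W h => by linarith [hW W h]
    linarith
  intro W hW
  have hdiff : ∀ y s, y - s ∈ Set.Icc a b → y + s ∈ Set.Icc a b → |s| ≤ δ →
      |f (y - s) - 2 * f y + f (y + s)| < W := fun y s hm hp hs =>
    (le_csSup (bddAbove_second_diff hf δ) ⟨y, s, hm, hp, hs, rfl⟩).trans_lt hW
  obtain ⟨q, hq⟩ : ∃ q, q = (f b - f a) / (b - a) := ⟨_, rfl⟩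
  have hqb : q * (b - a) = f b - f a := by rw [hq]; field_simp
  have hchord : ((b - x) * f a + (x - a) * f b) / (b - a) = f a + q * (x - a) := by
    rw [hq]; field_simp; ring
  have hup : ∀ t ∈ Set.Icc a b,
      f t ≤ (f a + W) + q * (t - a) + W / (2 * δ ^ 2) * ((t - a) * (b - t)) := by
    intro t ht
    have := le_of_neg_lt_second_diff hab hδ0 hδh (W := W)
      (g := fun t => f t - (f a + q * (t - a)))
      (hf.sub (by fun_prop)) (by ring) (by linarith)
      (fun y s hm hp hs => by linarith [(abs_lt.1 (hdiff y s hm hp hs)).1]) ht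
    linarith
  have hlo : ∀ t ∈ Set.Icc a b,
      (f a - W) + q * (t - a) + -(W / (2 * δ ^ 2)) * ((t - a) * (b - t)) ≤ f t := by
    intro t ht
    have := le_of_neg_lt_second_diff hab hδ0 hδh (W := W)
      (g := fun t => f a + q * (t - a) - f t)
      (ContinuousOn.sub (by fun_prop) hf) (by ring) (by linarith)
      (fun y s hm hp hs => by linarith [(abs_lt.1 (hdiff y s hm hp hs)).2]) ht
    linarith
  have hU := bernAB_iterate_mono hab hn hup r x ⟨hxa, hxb⟩
  have hL := bernAB_iterate_mono hab hn hlo r x ⟨hxa, hxb⟩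
  rw [bernAB_iterate_quadratic hab hn] at hU hL
  beta_reduce at hU hL
  have hhalf : W / (2 * δ ^ 2) * (1 - 1 / (n : ℝ)) ^ r * ((x - a) * (b - x)) = W / 2 := by
    rw [mul_assoc, mul_comm (_ ^ r), ← hD, hδD]
    field_simp
  rw [neg_mul, neg_mul, hhalf] at hL
  rw [hhalf] at hU
  rw [hchord]
  exact abs_le.2 ⟨by linarith, by linarith⟩
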